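/- arXiv:2004.01821 — 6 statements merged into one kernel-verified Lean document; each statement's English description precedes it below -/
import Mathlib

section
/- (Proposition 1, lower bound, pointwise form.) Let (Ω, ℱ, P) be a probability space, n ∈ ℕ, and let ℝⁿ denote Fin n → ℝ with the sup norm. Let q, q' ⊆ ℝⁿ, μ : ℝⁿ → ℝⁿ, ε > 0, and F : Ω → ℝⁿ → ℝⁿ such that for each x ∈ q the event {ω : F ω x ∈ q'} is measurable. For each i ∈ Fin n let E_i = {ω : |(F ω x')ᵢ − (μ x')ᵢ| ≤ ε for all x' ∈ q}; assume each E_i is measurable and the family (E_i)_{i ∈ Fin n} is independent. Then for every x ∈ q, P({ω : F ω x ∈ q'}) ≥ 𝟙_{underline(q')}(μ x) · ∏_{i ∈ Fin n} P(E_i), where 𝟙_{underline(q')} is the indicator function of the ε-reduced set underline(q'). -/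
open MeasureTheory ProbabilityTheory

/-- A preconnected set that meets `t` and avoids its frontier is contained in `t`. -/
theorem IsPreconnected.subset_of_disjoint_frontier {X : Type*} [TopologicalSpace X]
    {s t : Set X} (hs : IsPreconnected s) (hst : (s ∩ t).Nonempty)
    (hd : Disjoint s (frontier t)) : s ⊆ t := by
  have mem_interior {y : X} (hys : y ∈ s) (hyt : y ∈ t) : y ∈ interior t := by
    by_contra hy
    exact Set.disjoint_left.1 hd hys ⟨subset_closure hyt, hy⟩
  have hcover : s ⊆ interior t ∪ (closure t)ᶜ := by
    intro y hy
    by_cases hyt : y ∈ interior t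
    · exact Or.inl hyt
    · exact Or.inr fun hc => Set.disjoint_left.1 hd hy ⟨hc, hyt⟩
  have hdisj : Disjoint (interior t) (closure t)ᶜ :=
    Set.disjoint_compl_right_iff_subset.2 (interior_subset.trans subset_closure)
  obtain ⟨y, hys, hyt⟩ := hst
  exact (hs.subset_left_of_subset_union isOpen_interior isClosed_closure.isOpen_compl
    hdisj hcover ⟨y, hys, mem_interior hys hyt⟩).trans interior_subset

/-- A closed ball centred in `t` whose centre is at distance more than `ε` from the frontier
of `t` is contained in `t`. -/
theorem closedBall_subset_of_lt_norm_sub_frontier {V : Type*} [NormedAddCommGroup V]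
    [NormedSpace ℝ V] {t : Set V} {z : V} {ε : ℝ} (hε : 0 ≤ ε) (hz : z ∈ t)
    (h : ∀ y ∈ frontier t, ε < ‖z - y‖) : Metric.closedBall z ε ⊆ t := by
  refine (convex_closedBall z ε).isPreconnected.subset_of_disjoint_frontier
    ⟨z, Metric.mem_closedBall_self hε, hz⟩ (Set.disjoint_left.2 fun y hy hyt => ?_)
  rw [mem_closedBall_iff_norm'] at hy
  exact (h y hyt).not_ge hy

/-- Proposition 1, lower bound, pointwise form: the probability that `F ω x ∈ q'`
is at least the indicator of the `ε`-reduced set of `q'` at `μ x` times the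
product of the probabilities of the uniform-closeness events. -/
theorem prop1_lower_pointwise
    {Ω : Type*} [MeasurableSpace Ω] (P : Measure Ω) [IsProbabilityMeasure P]
    (n : ℕ) (q q' : Set (Fin n → ℝ)) (μ : (Fin n → ℝ) → (Fin n → ℝ)) (ε : ℝ) (hε : 0 < ε)
    (F : Ω → (Fin n → ℝ) → (Fin n → ℝ))
    (hq'meas : ∀ x ∈ q, MeasurableSet {ω : Ω | F ω x ∈ q'})
    (E : Fin n → Set Ω)
    (hE : ∀ i, E i = {ω : Ω | ∀ x' ∈ q, |F ω x' i - μ x' i| ≤ ε})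
    (hmeas : ∀ i, MeasurableSet (E i))
    (hind : iIndepSet E P)
    (x : Fin n → ℝ) (hx : x ∈ q) :
    Set.indicator {z ∈ q' | ∀ x' ∈ frontier q', ε < ‖z - x'‖}
        (fun _ => (1 : ENNReal)) (μ x) * ∏ i, P (E i)
      ≤ P {ω : Ω | F ω x ∈ q'} := by
  by_cases hμ : μ x ∈ {z ∈ q' | ∀ x' ∈ frontier q', ε < ‖z - x'‖}
  · rw [Set.indicator_of_mem hμ, one_mul]
    calc ∏ i, P (E i) = P (⋂ i, E i) := by
          simpa using ((iIndepSet_iff_meas_biInter hmeas).1 hind Finset.univ).symm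
      _ ≤ P {ω : Ω | F ω x ∈ q'} := measure_mono fun ω hω => by
          refine closedBall_subset_of_lt_norm_sub_frontier hε.le hμ.1 hμ.2 ?_
          rw [mem_closedBall_iff_norm, pi_norm_le_iff_of_nonneg hε.le]
          intro i
          have hi := Set.mem_iInter.1 hω i
          rw [hE] at hi
          exact hi x hx
  · rw [Set.indicator_of_notMem hμ, zero_mul]
    exact zero_le
end

section
/- (Proposition 1, upper bound, pointwise form.) Let (Ω, ℱ, P) be a probability space, n ∈ ℕ, and let ℝⁿ denote Fin n → ℝ with the sup norm. Let q, q' ⊆ ℝⁿ, μ : ℝⁿ → ℝⁿ, ε > 0, and F : Ω → ℝⁿ → ℝⁿ such that for each x ∈ q the event {ω : F ω x ∈ q'} is measurable. For each i ∈ Fin n let E_i = {ω : |(F ω x')ᵢ − (μ x')ᵢ| ≤ ε for all x' ∈ q}; assume each E_i is measurable and the family (E_i)_{i ∈ Fin n} is independent. Then for every x ∈ q, P({ω : F ω x ∈ q'}) ≤ 1 − (∏_{i ∈ Fin n} P(E_i)) · (1 − 𝟙_{overline(q')}(μ x)), where 𝟙_{overline(q')} is the indicator function of the ε-enlarged set overline(q').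 -/
open MeasureTheory ProbabilityTheory

/-- Proposition 1, upper bound, pointwise form: the probability that `F ω x ∈ q'`
is at most `1 - (∏ i, P (E i)) * (1 - 𝟙_{overline(q')}(μ x))`. -/
theorem prop1_upper_pointwise
    {Ω : Type*} [MeasurableSpace Ω] (P : Measure Ω) [IsProbabilityMeasure P]
    (n : ℕ) (q q' : Set (Fin n → ℝ)) (μ : (Fin n → ℝ) → (Fin n → ℝ)) (ε : ℝ) (hε : 0 < ε)
    (F : Ω → (Fin n → ℝ) → (Fin n → ℝ))
    (hq'meas : ∀ x ∈ q, MeasurableSet {ω : Ω | F ω x ∈ q'})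
    (E : Fin n → Set Ω)
    (hE : ∀ i, E i = {ω : Ω | ∀ x' ∈ q, |F ω x' i - μ x' i| ≤ ε})
    (hmeas : ∀ i, MeasurableSet (E i))
    (hind : iIndepSet E P)
    (x : Fin n → ℝ) (hx : x ∈ q) :
    P {ω : Ω | F ω x ∈ q'}
      ≤ 1 - (∏ i, P (E i)) *
          (1 - Set.indicator {z : Fin n → ℝ | ∃ x' ∈ q', ‖z - x'‖ ≤ ε}
            (fun _ => (1 : ENNReal)) (μ x)) := by
  by_cases h : μ x ∈ {z : Fin n → ℝ | ∃ x' ∈ q', ‖z - x'‖ ≤ ε}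
  · simpa [Set.indicator_of_mem h] using prob_le_one
  · have hprod : P (⋂ i, E i) = ∏ i, P (E i) := by
      simpa using hind.meas_biInter Finset.univ
    rw [Set.indicator_of_notMem h, tsub_zero, mul_one, ← hprod,
      ← prob_compl_eq_one_sub (MeasurableSet.iInter hmeas)]
    refine measure_mono fun ω hω hωE => h ⟨F ω x, hω, ?_⟩
    rw [pi_norm_le_iff_of_nonneg hε.le]
    intro i
    have hi := Set.mem_iInter.1 hωE i
    rw [hE i] at hi
    simpa [Real.norm_eq_abs, abs_sub_comm] using hi x hx
end

section
/- (Proposition 1, lower bound, infimum form.) Let (Ω, ℱ, P) be a probability space, n ∈ ℕ, and let ℝⁿ denote Fin n → ℝ with the sup norm. Let q, q' ⊆ ℝⁿ, μ : ℝⁿ → ℝⁿ, ε > 0, and F : Ω → ℝⁿ → ℝⁿ such that for each x ∈ q the event {ω : F ω x ∈ q'} is measurable. For each i ∈ Fin n let E_i = {ω : |(F ω x')ᵢ − (μ x')ᵢ| ≤ ε for all x' ∈ q}; assume each E_i is measurable and the family (E_i)_{i ∈ Fin n} is independent. Then the infimum over x ∈ q of P({ω : F ω x ∈ q'}) is at least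 the infimum over x ∈ q of 𝟙_{underline(q')}(μ x) · ∏_{i ∈ Fin n} P(E_i), where 𝟙_{underline(q')} is the indicator function of the ε-reduced set underline(q'). -/
open MeasureTheory ProbabilityTheory

/-- A point of `s` whose distance to the frontier exceeds `ε` has its closed `ε`-ball inside `s`. -/
theorem closedBall_subset_of_forall_frontier_lt {V : Type*} [NormedAddCommGroup V]
    [NormedSpace ℝ V] {s : Set V} {z : V} {ε : ℝ} (hz : z ∈ s)
    (hfr : ∀ y ∈ frontier s, ε < ‖z - y‖) : Metric.closedBall z ε ⊆ s := by
  intro w hw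
  have hz_mem : z ∈ Metric.closedBall z ε := Metric.mem_closedBall_self (dist_nonneg.trans hw)
  have hcover : Metric.closedBall z ε ⊆ interior s ∪ interior sᶜ := by
    rw [← compl_frontier_eq_union_interior]
    intro y hy hyf
    rw [Metric.mem_closedBall, dist_comm, dist_eq_norm] at hy
    exact (hfr y hyf).not_ge hy
  have hdisj : Disjoint (interior s) (interior sᶜ) :=
    disjoint_compl_right.mono interior_subset interior_subset
  rcases (convex_closedBall z ε).isPreconnected.subset_or_subset isOpen_interior
    isOpen_interior hdisj hcover with h | h
  · exact interior_subset (h hw)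
  · exact absurd hz (interior_subset (h hz_mem))

/-- Proposition 1, lower bound, infimum form. -/
theorem prop1_lower_inf
    {Ω : Type*} [MeasurableSpace Ω] (P : Measure Ω) [IsProbabilityMeasure P]
    (n : ℕ) (q q' : Set (Fin n → ℝ)) (μ : (Fin n → ℝ) → (Fin n → ℝ)) (ε : ℝ) (hε : 0 < ε)
    (F : Ω → (Fin n → ℝ) → (Fin n → ℝ))
    (hq'meas : ∀ x ∈ q, MeasurableSet {ω : Ω | F ω x ∈ q'})
    (E : Fin n → Set Ω)
    (hE : ∀ i, E i = {ω : Ω | ∀ x' ∈ q, |F ω x' i - μ x' i| ≤ ε})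
    (hmeas : ∀ i, MeasurableSet (E i))
    (hind : iIndepSet E P) :
    (⨅ x ∈ q, Set.indicator {z ∈ q' | ∀ x' ∈ frontier q', ε < ‖z - x'‖}
        (fun _ => (1 : ENNReal)) (μ x) * ∏ i, P (E i))
      ≤ ⨅ x ∈ q, P {ω : Ω | F ω x ∈ q'} := by
  refine le_iInf₂ fun x hx => (iInf₂_le x hx).trans ?_
  by_cases hμ : μ x ∈ {z ∈ q' | ∀ x' ∈ frontier q', ε < ‖z - x'‖}
  · rw [Set.indicator_of_mem hμ, one_mul]
    have hprod : P (⋂ i, E i) = ∏ i, P (E i) := by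
      simpa using hind.meas_biInter Finset.univ
    rw [← hprod]
    refine measure_mono fun ω hω => closedBall_subset_of_forall_frontier_lt hμ.1 hμ.2 ?_
    refine (dist_pi_le_iff hε.le).2 fun i => ?_
    have hi : ω ∈ E i := Set.mem_iInter.1 hω i
    rw [hE i] at hi
    exact hi x hx
  · rw [Set.indicator_of_notMem hμ, zero_mul]
    exact zero_le
end

section
/- (Proposition 1, upper bound, supremum form.) Let (Ω, ℱ, P) be a probability space, n ∈ ℕ, and let ℝⁿ denote Fin n → ℝ with the sup norm. Let q, q' ⊆ ℝⁿ, μ : ℝⁿ → ℝⁿ, ε > 0, and F : Ω → ℝⁿ → ℝⁿ such that for each x ∈ q the event {ω : F ω x ∈ q'} is measurable. For each i ∈ Fin n let E_i = {ω : |(F ω x')ᵢ − (μ x')ᵢ| ≤ ε for all x' ∈ q}; assume each E_i is measurable and the family (E_i)_{i ∈ Fin n} is independent. Then the supremum over x ∈ q of P({ω : F ω x ∈ q'}) is at most the supremum over x ∈ q of 1 − (∏_{i ∈ Fin n} P(E_i)) · (1 − 𝟙_{overline(q')}(μ x)), where 𝟙_{overline(q')} is the indicator function of the ε-enlarged set overline(q').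 -/
open MeasureTheory ProbabilityTheory

/-- Proposition 1, upper bound, supremum form. -/
theorem prop1_upper_sup
    {Ω : Type*} [MeasurableSpace Ω] (P : Measure Ω) [IsProbabilityMeasure P]
    (n : ℕ) (q q' : Set (Fin n → ℝ)) (μ : (Fin n → ℝ) → (Fin n → ℝ)) (ε : ℝ) (hε : 0 < ε)
    (F : Ω → (Fin n → ℝ) → (Fin n → ℝ))
    (hq'meas : ∀ x ∈ q, MeasurableSet {ω : Ω | F ω x ∈ q'})
    (E : Fin n → Set Ω)
    (hE : ∀ i, E i = {ω : Ω | ∀ x' ∈ q, |F ω x' i - μ x' i| ≤ ε})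
    (hmeas : ∀ i, MeasurableSet (E i))
    (hind : iIndepSet E P) :
    (⨆ x ∈ q, P {ω : Ω | F ω x ∈ q'})
      ≤ ⨆ x ∈ q, (1 - (∏ i, P (E i)) *
          (1 - Set.indicator {z : Fin n → ℝ | ∃ x' ∈ q', ‖z - x'‖ ≤ ε}
            (fun _ => (1 : ENNReal)) (μ x))) := by
  refine iSup₂_mono fun x hx => ?_
  by_cases hμ : μ x ∈ {z : Fin n → ℝ | ∃ x' ∈ q', ‖z - x'‖ ≤ ε}
  · simpa [Set.indicator_of_mem hμ] using prob_le_one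
  · have hprod : P (⋂ i, E i) = ∏ i, P (E i) := by
      simpa using hind.meas_biInter Finset.univ
    rw [Set.indicator_of_notMem hμ, tsub_zero, mul_one, ← hprod,
      ← prob_compl_eq_one_sub (MeasurableSet.iInter hmeas)]
    refine measure_mono fun ω hω hE' => hμ ⟨F ω x, hω, ?_⟩
    refine (pi_norm_le_iff_of_nonneg hε.le).2 fun i => ?_
    have hi := Set.mem_iInter.1 hE' i
    rw [hE i] at hi
    rw [Pi.sub_apply, Real.norm_eq_abs, abs_sub_comm]
    exact hi x hx
end

section
/- (Theorem 1, lower bound.) Let (Ω, ℱ, P) be a probability space, n ∈ ℕ, and let ℝⁿ denote Fin n → ℝ with the sup norm. Let q, q' ⊆ ℝⁿ, μ : ℝⁿ → ℝⁿ, ε > 0, δ ∈ (0, 1), and F : Ω → ℝⁿ → ℝⁿ such that for each x ∈ q the event {ω : F ω x ∈ q'} is measurable. For each i ∈ Fin n let E_i = {ω : |(F ω x')ᵢ − (μ x')ᵢ| ≤ ε for all x' ∈ q}; assume each E_i is measurable, the family (E_i)_{i ∈ Fin n} is independent, and P(E_i) ≥ 1 − δ for every i. Then for every x ∈ q, P({ω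 : F ω x ∈ q'}) ≥ 𝟙_{underline(q')}(μ x) · (1 − δ)^n, where 𝟙_{underline(q')} is the indicator function of the ε-reduced set underline(q'). -/
open MeasureTheory ProbabilityTheory

/-- A closed ball centred in `s` that does not meet the frontier of `s` is contained in `s`. -/
theorem closedBall_subset_of_frontier_far {V : Type*} [NormedAddCommGroup V] [NormedSpace ℝ V]
    {s : Set V} {z : V} {ε : ℝ} (hε : 0 ≤ ε) (hz : z ∈ s)
    (hfar : ∀ y ∈ frontier s, ε < ‖z - y‖) : Metric.closedBall z ε ⊆ s := by
  have hdisj : ∀ y ∈ Metric.closedBall z ε, y ∉ frontier s := fun y hy hyf =>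
    (hfar y hyf).not_ge (by rwa [Metric.mem_closedBall', dist_eq_norm] at hy)
  have hcover : Metric.closedBall z ε ⊆ interior s ∪ interior sᶜ := fun y hy => by
    by_contra hmem
    refine hdisj y hy ?_
    rw [frontier_eq_closure_inter_closure, closure_eq_compl_interior_compl (s := s),
      closure_compl]
    exact ⟨fun h => hmem (Or.inr h), fun h => hmem (Or.inl h)⟩
  have hzball := Metric.mem_closedBall_self (x := z) hε
  have hzint : z ∈ interior s := (hcover hzball).resolve_right fun h => interior_subset h hz
  exact ((convex_closedBall z ε).isPreconnected.subset_left_of_subset_union isOpen_interior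
    isOpen_interior (disjoint_compl_right.mono interior_subset interior_subset) hcover
    ⟨z, hzball, hzint⟩).trans interior_subset

/-- Theorem 1, lower bound: if each closeness event has probability at least `1 - δ`,
then `P(F ω x ∈ q') ≥ 𝟙_{underline(q')}(μ x) · (1 - δ)^n`. -/
theorem thm1_lower
    {Ω : Type*} [MeasurableSpace Ω] (P : Measure Ω) [IsProbabilityMeasure P]
    (n : ℕ) (q q' : Set (Fin n → ℝ)) (μ : (Fin n → ℝ) → (Fin n → ℝ)) (ε : ℝ) (hε : 0 < ε)
    (δ : ℝ) (hδ : δ ∈ Set.Ioo (0 : ℝ) 1)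
    (F : Ω → (Fin n → ℝ) → (Fin n → ℝ))
    (hq'meas : ∀ x ∈ q, MeasurableSet {ω : Ω | F ω x ∈ q'})
    (E : Fin n → Set Ω)
    (hE : ∀ i, E i = {ω : Ω | ∀ x' ∈ q, |F ω x' i - μ x' i| ≤ ε})
    (hmeas : ∀ i, MeasurableSet (E i))
    (hind : iIndepSet E P)
    (hP : ∀ i, ENNReal.ofReal (1 - δ) ≤ P (E i))
    (x : Fin n → ℝ) (hx : x ∈ q) :
    Set.indicator {z ∈ q' | ∀ x' ∈ frontier q', ε < ‖z - x'‖}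
        (fun _ => (1 : ENNReal)) (μ x) * ENNReal.ofReal (1 - δ) ^ n
      ≤ P {ω : Ω | F ω x ∈ q'} := by
  by_cases hz : μ x ∈ {z ∈ q' | ∀ x' ∈ frontier q', ε < ‖z - x'‖}
  · rw [Set.indicator_of_mem hz, one_mul]
    have hball := closedBall_subset_of_frontier_far hε.le hz.1 hz.2
    calc ENNReal.ofReal (1 - δ) ^ n = ∏ _i : Fin n, ENNReal.ofReal (1 - δ) := by simp
      _ ≤ ∏ i, P (E i) := Finset.prod_le_prod' fun i _ => hP i
      _ = P (⋂ i, E i) := by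
        simpa using ((iIndepSet_iff_meas_biInter hmeas).mp hind Finset.univ).symm
      _ ≤ P {ω : Ω | F ω x ∈ q'} := by
        refine measure_mono fun ω hω => hball ?_
        rw [Metric.mem_closedBall, dist_pi_le_iff hε.le]
        intro i
        have hωi := Set.mem_iInter.mp hω i
        rw [hE i] at hωi
        exact hωi x hx
  · rw [Set.indicator_of_notMem hz, zero_mul]
    exact zero_le
end

section
/- (Theorem 1, upper bound.) Let (Ω, ℱ, P) be a probability space, n ∈ ℕ, and let ℝⁿ denote Fin n → ℝ with the sup norm. Let q, q' ⊆ ℝⁿ, μ : ℝⁿ → ℝⁿ, ε > 0, δ ∈ (0, 1), and F : Ω → ℝⁿ → ℝⁿ such that for each x ∈ q the event {ω : F ω x ∈ q'} is measurable. For each i ∈ Fin n let E_i = {ω : |(F ω x')ᵢ − (μ x')ᵢ| ≤ ε for all x' ∈ q}; assume each E_i is measurable, the family (E_i)_{i ∈ Fin n} is independent, and P(E_i) ≥ 1 − δ for every i. Then for every x ∈ q, P({ω : F ω x ∈ q'}) ≤ 1 − (1 − δ)^n · (1 − 𝟙_{overline(q')}(μ x)), where 𝟙_{overline(q')} is the indicator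 function of the ε-enlarged set overline(q'). -/
open MeasureTheory ProbabilityTheory

/-- Theorem 1, upper bound: if each closeness event has probability at least `1 - δ`,
then `P(F ω x ∈ q') ≤ 1 - (1 - δ)^n · (1 - 𝟙_{overline(q')}(μ x))`. -/
theorem thm1_upper
    {Ω : Type*} [MeasurableSpace Ω] (P : Measure Ω) [IsProbabilityMeasure P]
    (n : ℕ) (q q' : Set (Fin n → ℝ)) (μ : (Fin n → ℝ) → (Fin n → ℝ)) (ε : ℝ) (hε : 0 < ε)
    (δ : ℝ) (hδ : δ ∈ Set.Ioo (0 : ℝ) 1)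
    (F : Ω → (Fin n → ℝ) → (Fin n → ℝ))
    (hq'meas : ∀ x ∈ q, MeasurableSet {ω : Ω | F ω x ∈ q'})
    (E : Fin n → Set Ω)
    (hE : ∀ i, E i = {ω : Ω | ∀ x' ∈ q, |F ω x' i - μ x' i| ≤ ε})
    (hmeas : ∀ i, MeasurableSet (E i))
    (hind : iIndepSet E P)
    (hP : ∀ i, ENNReal.ofReal (1 - δ) ≤ P (E i))
    (x : Fin n → ℝ) (hx : x ∈ q) :
    P {ω : Ω | F ω x ∈ q'}
      ≤ 1 - ENNReal.ofReal (1 - δ) ^ n *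
          (1 - Set.indicator {z : Fin n → ℝ | ∃ x' ∈ q', ‖z - x'‖ ≤ ε}
            (fun _ => (1 : ENNReal)) (μ x)) := by
  by_cases hμ : μ x ∈ {z : Fin n → ℝ | ∃ x' ∈ q', ‖z - x'‖ ≤ ε}
  · rw [Set.indicator_of_mem hμ]
    simpa using prob_le_one
  · rw [Set.indicator_of_notMem hμ, tsub_zero, mul_one]
    have hsub : {ω : Ω | F ω x ∈ q'} ⊆ (⋂ i, E i)ᶜ := by
      intro ω hω hmem
      refine hμ ⟨F ω x, hω, (pi_norm_le_iff_of_nonneg hε.le).2 fun i => ?_⟩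
      have hi := Set.mem_iInter.1 hmem i
      rw [hE i] at hi
      rw [Pi.sub_apply, Real.norm_eq_abs, abs_sub_comm]
      exact hi x hx
    have hprod : P (⋂ i, E i) = ∏ i, P (E i) := by
      simpa using hind.meas_biInter Finset.univ
    have hpow : ENNReal.ofReal (1 - δ) ^ n ≤ P (⋂ i, E i) := by
      rw [hprod]
      simpa using Finset.prod_le_prod' (s := Finset.univ) fun i _ => hP i
    calc P {ω : Ω | F ω x ∈ q'} ≤ P (⋂ i, E i)ᶜ := measure_mono hsub
      _ = 1 - P (⋂ i, E i) := prob_compl_eq_one_sub (MeasurableSet.iInter hmeas)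
      _ ≤ 1 - ENNReal.ofReal (1 - δ) ^ n := tsub_le_tsub_left hpow 1
end
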